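/- arXiv:math/0303151 — 2 statements merged into one kernel-verified Lean document; each statement's English description precedes it below -/
import Mathlib

section
/- Let φ and ψ be 2×2 matrices over S whose entries are homogeneous polynomials of positive degree and which satisfy φψ = ψφ = f₄·I₂. Then there exist a,b ∈ K with a³ = b³ = −1 and indices i < j in {2,3,4} such that Coker φ is isomorphic as an R₄-module either to Coker φ_ij(a,b) or to Coker ψ_ij(a,b). -/
open MvPolynomial Matrix TensorProduct

set_option maxHeartbeats 1000000
set_option synthInstance.maxHeartbeats 400000

noncomputable section

/-- The polynomial ring `S = K[Y₁,Y₂,Y₃,Y₄]`. -/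
abbrev S (K : Type) [Field K] := MvPolynomial (Fin 4) K

/-- The variables `Y₁,…,Y₄` (indexed by `1,…,4`). -/
def Yv (K : Type) [Field K] : ℕ → S K
  | 1 => X 0
  | 2 => X 1
  | 3 => X 2
  | 4 => X 3
  | _ => 0

/-- `f₄ = Y₁³+Y₂³+Y₃³+Y₄³`. -/
def f4 (K : Type) [Field K] : S K :=
  Yv K 1 ^ 3 + Yv K 2 ^ 3 + Yv K 3 ^ 3 + Yv K 4 ^ 3

/-- The hypersurface ring `R₄ = S/(f₄)`. -/
abbrev R4 (K : Type) [Field K] := S K ⧸ Ideal.span {f4 K}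

/-- The canonical projection `S → R₄`. -/
abbrev proj (K : Type) [Field K] : S K →+* R4 K := Ideal.Quotient.mk (Ideal.span {f4 K})

/-- The `R₄`-linear map `R₄ⁿ → R₄ⁿ` induced by an `n × n` matrix over `S`. -/
abbrev mbar (K : Type) [Field K] {n : ℕ} (M : Matrix (Fin n) (Fin n) (S K)) :
    (Fin n → R4 K) →ₗ[R4 K] (Fin n → R4 K) :=
  Matrix.mulVecLin (M.map ⇑(proj K))

/-- The cokernel of the `R₄`-linear map induced by a matrix over `S`. -/
abbrev coker (K : Type) [Field K] {n : ℕ} (M : Matrix (Fin n) (Fin n) (S K)) :=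
  (Fin n → R4 K) ⧸ LinearMap.range (mbar K M)

/-- The matrix `φ_ij(a,b)`. -/
def phiM (K : Type) [Field K] (a b : K) (i j s : ℕ) : Matrix (Fin 2) (Fin 2) (S K) :=
  !![Yv K 1 - C a * Yv K s, -(Yv K i ^ 2 + C b * Yv K i * Yv K j + C b ^ 2 * Yv K j ^ 2);
     Yv K i - C b * Yv K j, Yv K 1 ^ 2 + C a * Yv K 1 * Yv K s + C a ^ 2 * Yv K s ^ 2]

/-- The matrix `ψ_ij(a,b)`. -/
def psiM (K : Type) [Field K] (a b : K) (i j s : ℕ) : Matrix (Fin 2) (Fin 2) (S K) :=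
  !![Yv K 1 ^ 2 + C a * Yv K 1 * Yv K s + C a ^ 2 * Yv K s ^ 2,
       Yv K i ^ 2 + C b * Yv K i * Yv K j + C b ^ 2 * Yv K j ^ 2;
     -(Yv K i - C b * Yv K j), Yv K 1 - C a * Yv K s]

/-- The set `𝓛_i` of linear forms `Y_i - a Y_j` with `a³ = -1` and `i < j ≤ 4`. -/
def Lset (K : Type) [Field K] (i : ℕ) : Set (S K) :=
  {p | ∃ (a : K) (j : ℕ), a ^ 3 = -1 ∧ i < j ∧ j ≤ 4 ∧ p = Yv K i - C a * Yv K j}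

/-- The matrix `α(b,c,d,ε)`, where `a = ε²bcd`. -/
def alphaM (K : Type) [Field K] (b c d ε : K) : Matrix (Fin 3) (Fin 3) (S K) :=
  let a := ε ^ 2 * b * c * d
  !![0, Yv K 1 - C a * Yv K 4, Yv K 2 - C b * Yv K 3;
     Yv K 1 - C c * Yv K 2, -(C (b ^ 2) * Yv K 3) - C (a * b * c ^ 2 * ε ^ 2) * Yv K 4,
       C (b ^ 2 * c ^ 2) * Yv K 3 - C (a * b * c * ε ^ 2) * Yv K 4;
     Yv K 3 - C d * Yv K 4, C (c ^ 2) * Yv K 2 + C (b * c ^ 2) * Yv K 3 + C (a * c) * Yv K 4,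
       -(Yv K 1) - C c * Yv K 2 - C a * Yv K 4]

/-- The matrix `β(b,c,d,ε)`, the transpose of `α(b,c,d,ε)`. -/
def betaM (K : Type) [Field K] (b c d ε : K) : Matrix (Fin 3) (Fin 3) (S K) :=
  (alphaM K b c d ε).transpose

/-- The matrix `η(a,b,c,ε)`. -/
def etaM (K : Type) [Field K] (a b c ε : K) : Matrix (Fin 3) (Fin 3) (S K) :=
  !![0, Yv K 1 + Yv K 2, Yv K 3 - C a * Yv K 4;
     Yv K 1 + C ε * Yv K 2, -(Yv K 3) + C c * Yv K 4, 0;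
     Yv K 3 - C b * Yv K 4, 0, -(Yv K 1) - C (ε ^ 2) * Yv K 2]

/-- The matrix `θ(a,b,c)` (denoted `ϑ(a,b,c)` in the paper). -/
def thetaM (K : Type) [Field K] (a b c : K) : Matrix (Fin 3) (Fin 3) (S K) :=
  !![0, Yv K 1 + Yv K 3, Yv K 2 - C a * Yv K 4;
     Yv K 1 - C (a ^ 2 * b) * Yv K 3, -(Yv K 2) + C c * Yv K 4, 0;
     Yv K 2 - C b * Yv K 4, 0, -(Yv K 1) + C (a * b ^ 2) * Yv K 3]

/-- The matrix `D((a,b,c),(p,q,r))`. -/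
def DM (K : Type) [Field K] (a b c p q r : K) : Matrix (Fin 3) (Fin 3) (S K) :=
  !![0, Yv K 1 - C a * Yv K 2, Yv K 3 - C p * Yv K 4;
     Yv K 1 - C c * Yv K 2, -(Yv K 3) + C r * Yv K 4, 0;
     Yv K 3 - C q * Yv K 4, 0, -(Yv K 1) + C b * Yv K 2]

/-- `(a,b,c)` is a permutation (i.e. an enumeration) of the three cube roots of `-1` in `K`. -/
def cubePerm (K : Type) [Field K] (a b c : K) : Prop :=
  a ^ 3 = -1 ∧ b ^ 3 = -1 ∧ c ^ 3 = -1 ∧ a ≠ b ∧ a ≠ c ∧ b ≠ c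



/-! ### Equivalence of matrices and cokernels -/

/-- Equivalence of square matrices over `S`. -/
def Eqv (K : Type) [Field K] (M N : Matrix (Fin 2) (Fin 2) (S K)) : Prop :=
  ∃ P Q : Matrix (Fin 2) (Fin 2) (S K), IsUnit P.det ∧ IsUnit Q.det ∧ P * M * Q = N

theorem Eqv.coker_equiv {K : Type} [Field K] {M N : Matrix (Fin 2) (Fin 2) (S K)}
    (h : Eqv K M N) : Nonempty (coker K M ≃ₗ[R4 K] coker K N) := by
  obtain ⟨P, Q, hP, hQ, rfl⟩ := h
  have hP' : IsUnit (P.map (proj K)) := by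
    have := ((Matrix.isUnit_iff_isUnit_det P).2 hP).map (proj K).mapMatrix
    simpa using this
  have hQ' : IsUnit (Q.map (proj K)) := by
    have := ((Matrix.isUnit_iff_isUnit_det Q).2 hQ).map (proj K).mapMatrix
    simpa using this
  obtain ⟨P', h1, h2⟩ := isUnit_iff_exists.1 hP'
  obtain ⟨Q', h3, h4⟩ := isUnit_iff_exists.1 hQ'
  let e : (Fin 2 → R4 K) ≃ₗ[R4 K] (Fin 2 → R4 K) :=
    LinearEquiv.ofLinearMap (Matrix.mulVecLin (P.map (proj K))) (Matrix.mulVecLin P')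
      (by rw [← Matrix.mulVecLin_mul, h1, Matrix.mulVecLin_one])
      (by rw [← Matrix.mulVecLin_mul, h2, Matrix.mulVecLin_one])
  refine ⟨Submodule.Quotient.equiv _ _ e ?_⟩
  ext v
  simp only [Submodule.mem_map, LinearMap.mem_range]
  constructor
  · rintro ⟨_, ⟨w, rfl⟩, rfl⟩
    refine ⟨Q' *ᵥ w, ?_⟩
    simp only [mbar, Matrix.mulVecLin_apply, Matrix.map_mul, Matrix.mulVec_mulVec, e]
    simp only [LinearEquiv.coe_coe, LinearEquiv.coe_ofLinearMap, Matrix.mulVecLin_apply,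
      Matrix.mulVec_mulVec, Matrix.mul_assoc, h3, Matrix.mul_one]
  · rintro ⟨w, rfl⟩
    refine ⟨_, ⟨(Q.map (proj K)) *ᵥ w, rfl⟩, ?_⟩
    simp only [mbar, Matrix.mulVecLin_apply, Matrix.map_mul, Matrix.mulVec_mulVec, e]
    simp only [LinearEquiv.coe_coe, LinearEquiv.coe_ofLinearMap, Matrix.mulVecLin_apply,
      Matrix.mulVec_mulVec, Matrix.mul_assoc]

theorem Eqv.trans {K : Type} [Field K] {M N L : Matrix (Fin 2) (Fin 2) (S K)}
    (h : Eqv K M N) (h' : Eqv K N L) : Eqv K M L := by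
  obtain ⟨P, Q, hP, hQ, rfl⟩ := h
  obtain ⟨P', Q', hP', hQ', rfl⟩ := h'
  refine ⟨P' * P, Q * Q', ?_, ?_, ?_⟩
  · rw [Matrix.det_mul]; exact hP'.mul hP
  · rw [Matrix.det_mul]; exact hQ.mul hQ'
  · simp only [Matrix.mul_assoc]

theorem Eqv.transpose {K : Type} [Field K] {M N : Matrix (Fin 2) (Fin 2) (S K)}
    (h : Eqv K M N) : Eqv K Mᵀ Nᵀ := by
  obtain ⟨P, Q, hP, hQ, rfl⟩ := h
  refine ⟨Qᵀ, Pᵀ, ?_, ?_, ?_⟩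
  · rwa [Matrix.det_transpose]
  · rwa [Matrix.det_transpose]
  · simp only [Matrix.transpose_mul, Matrix.mul_assoc]

theorem phi_transpose_eqv_psi (K : Type) [Field K] (a b : K) (i j s : ℕ) :
    Eqv K (phiM K a b i j s)ᵀ (psiM K a b i j s) := by
  refine ⟨!![0, 1; -1, 0], !![0, -1; 1, 0], ?_, ?_, ?_⟩
  · simp [Matrix.det_fin_two]
  · simp [Matrix.det_fin_two]
  · have hT : ∀ p q r t : S K, !![p, q; r, t]ᵀ = !![p, r; q, t] := by
      intro p q r t
      ext x y
      fin_cases x <;> fin_cases y <;> rfl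
    rw [phiM, psiM, hT, Matrix.mul_fin_two, Matrix.mul_fin_two]
    congr 1 <;> ring_nf

theorem swap_eqv (K : Type) [Field K] (p q r t : S K) :
    Eqv K !![p, q; r, t] !![q, p; t, r] := by
  refine ⟨1, !![0, 1; 1, 0], ?_, ?_, ?_⟩
  · simp
  · simp [Matrix.det_fin_two]
  · ext x y
    fin_cases x <;> fin_cases y <;> simp [Matrix.mul_apply, Fin.sum_univ_two]

/-! ### Linear forms and the cubic -/

theorem lin_form {K : Type} [Field K] {p : S K} (hp : p.IsHomogeneous 1) :
    ∃ c : Fin 4 → K, p = ∑ i, C (c i) * X i := by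
  have h : p ∈ homogeneousSubmodule (Fin 4) K 1 := hp
  rw [homogeneousSubmodule_one_eq_span_X, Submodule.mem_span_range_iff_exists_fun] at h
  obtain ⟨c, hc⟩ := h
  exact ⟨c, by rw [← hc]; simp [MvPolynomial.smul_eq_C_mul]⟩

theorem f4_eq (K : Type) [Field K] : f4 K = ∑ i, X i ^ 3 := by
  simp [f4, Yv, Fin.sum_univ_four]

theorem f4_hom (K : Type) [Field K] : (f4 K).IsHomogeneous 3 := by
  rw [f4_eq]
  exact IsHomogeneous.sum _ _ _ fun i _ => isHomogeneous_X_pow i 3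

theorem sum_four {M : Type*} [AddCommMonoid M] {k l u v : Fin 4} (h : [k, l, u, v].Nodup)
    (g : Fin 4 → M) : ∑ i, g i = g k + g l + g u + g v := by
  have h1 : (Finset.univ : Finset (Fin 4)) = {k, l, u, v} := by
    revert k l u v; decide
  simp only [List.nodup_cons, List.mem_cons, List.not_mem_nil, or_false, not_or] at h
  obtain ⟨⟨h1', h2, h3⟩, ⟨h4, h5⟩, h6, -⟩ := h
  rw [h1, Finset.sum_insert (by simp [*]), Finset.sum_insert (by simp [*]),
    Finset.sum_insert (by simp [*]), Finset.sum_singleton]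
  simp only [add_assoc]

theorem f4_ne (K : Type) [Field K] : f4 K ≠ 0 := by
  intro h
  have := congrArg (eval (Pi.single (0 : Fin 4) (1 : K))) h
  rw [f4_eq] at this
  simp [Fin.sum_univ_four] at this

/-- A nonconstant affine form does not divide the cubic. -/
theorem no_affine {K : Type} [Field K] [CharZero K] (c : Fin 4 → K) (e : K) (hc : c ≠ 0) :
    ¬ (∀ x : Fin 4 → K, e + ∑ i, c i * x i = 0 → ∑ i, x i ^ 3 = 0) := by
  intro H
  obtain ⟨k, hk⟩ : ∃ k, c k ≠ 0 := by
    by_contra! h; exact hc (funext h)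
  obtain ⟨l, u, v, hn⟩ : ∃ l u v : Fin 4, [k, l, u, v].Nodup := by
    clear hk; revert k; decide
  have hn' := hn
  simp only [List.nodup_cons, List.mem_cons, List.not_mem_nil, or_false, not_or] at hn'
  obtain ⟨⟨h1, h2, h3⟩, ⟨h4, h5⟩, h6, -⟩ := hn'
  have key : ∀ x y : K, (-(c l / c k) * x - (c u / c k) * y - e / c k) ^ 3 + x ^ 3 + y ^ 3 = 0 := by
    intro x y
    have := H (fun i => if i = k then (-(c l / c k) * x - (c u / c k) * y - e / c k) else
      if i = l then x else if i = u then y else 0)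
    rw [sum_four hn, sum_four hn] at this
    simp only [if_true, Ne.symm h1, Ne.symm h2, Ne.symm h3, Ne.symm h4, Ne.symm h5, Ne.symm h6,
      if_false] at this
    have h := this (by field_simp; ring)
    linear_combination h
  generalize -(c l / c k) = m at key
  generalize c u / c k = n at key
  generalize e / c k = o at key
  have e1 : m ^ 3 = -1 := by
    have : (6 : K) * (m ^ 3 + 1) = 0 := by
      linear_combination key 3 0 - 3 * key 2 0 + 3 * key 1 0 - key 0 0
    have := (mul_eq_zero.1 this).resolve_left (by norm_num)
    linear_combination this
  have e2 : n ^ 3 = 1 := by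
    have : (6 : K) * (n ^ 3 - 1) = 0 := by
      linear_combination -key 0 3 + 3 * key 0 2 - 3 * key 0 1 + key 0 0
    have := (mul_eq_zero.1 this).resolve_left (by norm_num)
    linear_combination this
  have e3 : m ^ 2 * n = 0 := by
    have : (6 : K) * (m ^ 2 * n) = 0 := by
      linear_combination -(key 2 1 - 2 * key 1 1 + key 0 1 - key 2 0 + 2 * key 1 0 - key 0 0)
    exact (mul_eq_zero.1 this).resolve_left (by norm_num)
  rcases mul_eq_zero.1 e3 with h | h
  · have : m = 0 := by simpa using h
    rw [this] at e1; norm_num at e1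
  · rw [h] at e2; norm_num at e2

theorem affine_of_totalDegree_one {K : Type} [Field K] {g : S K} (hg : g.totalDegree = 1) :
    ∃ (c : Fin 4 → K) (e : K), c ≠ 0 ∧ g = C e + ∑ i, C (c i) * X i := by
  have h := sum_homogeneousComponent g
  rw [hg, Finset.sum_range_succ, Finset.sum_range_one, homogeneousComponent_zero] at h
  obtain ⟨c, hc⟩ := lin_form (homogeneousComponent_isHomogeneous 1 g)
  rw [hc] at h
  refine ⟨c, coeff 0 g, ?_, h.symm⟩
  rintro rfl
  simp only [Pi.zero_apply, map_zero, zero_mul, Finset.sum_const_zero, add_zero] at h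
  rw [← h, totalDegree_C] at hg
  exact absurd hg (by norm_num)

theorem f4_irreducible (K : Type) [Field K] [CharZero K] : Irreducible (f4 K) := by
  have hne := f4_ne K
  have hdeg : (f4 K).totalDegree = 3 := (f4_hom K).totalDegree hne
  have main : ∀ a b : S K, f4 K = a * b → a.totalDegree ≠ 1 := by
    intro a b hab ha
    obtain ⟨c, e, hc, rfl⟩ := affine_of_totalDegree_one ha
    refine no_affine c e hc fun x hx => ?_
    have := congrArg (eval x) hab
    rw [f4_eq] at this
    simpa [hx] using this
  have unit0 : ∀ a : S K, a ≠ 0 → a.totalDegree = 0 → IsUnit a := by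
    intro a ha h
    rw [totalDegree_eq_zero_iff_eq_C] at h
    rw [h] at ha ⊢
    refine IsUnit.map C (IsUnit.mk0 _ ?_)
    rintro h0; rw [h0] at ha; simp at ha
  refine ⟨fun h => ?_, fun a b hab => ?_⟩
  · have := (MvPolynomial.isUnit_iff_totalDegree_of_isReduced.mp h).2
    omega
  · have ha : a ≠ 0 := by rintro rfl; simp at hab; exact hne hab
    have hb : b ≠ 0 := by rintro rfl; simp at hab; exact hne hab
    have hd : a.totalDegree + b.totalDegree = 3 := by
      rw [← totalDegree_mul_of_isDomain ha hb, ← hab, hdeg]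
    have h1 := main a b hab
    have h2 := main b a (by rw [hab, mul_comm])
    have : a.totalDegree = 0 ∨ b.totalDegree = 0 := by omega
    exact this.imp (unit0 a ha) (unit0 b hb)

/-- Polynomials without constant term. -/
theorem not_unit_of_eval {K : Type} [Field K] {p : S K} (hp : eval 0 p = 0) : ¬ IsUnit p := by
  intro h
  have := h.map (eval (0 : Fin 4 → K))
  rw [hp] at this
  exact not_isUnit_zero this

theorem eval_zero_of_hom {K : Type} [Field K] {p : S K} {d : ℕ} (hd : 0 < d)
    (hp : p.IsHomogeneous d) : eval 0 p = 0 := by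
  have h : coeff 0 p = 0 := hp.coeff_eq_zero (by simp; omega)
  simpa [MvPolynomial.constantCoeff_eq] using h

theorem no_prod {K : Type} [Field K] [CharZero K] {p q : S K} {c : K} (hc : c ≠ 0)
    (hp : eval 0 p = 0) (hq : eval 0 q = 0) : p * q ≠ C c * f4 K := by
  intro h
  have h' : f4 K = (C c⁻¹ * p) * q := by
    rw [mul_assoc, h, ← mul_assoc, ← C_mul, inv_mul_cancel₀ hc, C_1, one_mul]
  rcases (f4_irreducible K).isUnit_or_isUnit h' with h1 | h1
  · exact not_unit_of_eval (by rw [map_mul, hp, mul_zero]) h1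
  · exact not_unit_of_eval hq h1

/-! ### Lines on the cubic -/

theorem line_algebra {K : Type} [Field K] [CharZero K] (m n m' n' : K)
    (h : ∀ x y : K, (m * x + n * y) ^ 3 + (m' * x + n' * y) ^ 3 + x ^ 3 + y ^ 3 = 0) :
    (m = 0 ∧ n' = 0 ∧ n ^ 3 = -1 ∧ m' ^ 3 = -1) ∨
    (n = 0 ∧ m' = 0 ∧ m ^ 3 = -1 ∧ n' ^ 3 = -1) := by
  have a1 : m ^ 3 + m' ^ 3 = -1 := by linear_combination h 1 0
  have a2 : n ^ 3 + n' ^ 3 = -1 := by linear_combination h 0 1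
  have a3 : m ^ 2 * n + m' ^ 2 * n' = 0 := by
    have : (6 : K) * (m ^ 2 * n + m' ^ 2 * n') = 0 := by
      linear_combination h 1 1 - h 1 (-1) - 2 * a2
    exact (mul_eq_zero.1 this).resolve_left (by norm_num)
  have a4 : m * n ^ 2 + m' * n' ^ 2 = 0 := by
    have : (6 : K) * (m * n ^ 2 + m' * n' ^ 2) = 0 := by
      linear_combination h 1 1 + h 1 (-1) - 2 * a1
    exact (mul_eq_zero.1 this).resolve_left (by norm_num)
  have one : (1 : K) ≠ 0 := one_ne_zero
  by_cases hm : m = 0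
  · left
    subst hm
    have e1 : m' ^ 3 = -1 := by linear_combination a1
    have hm' : m' ≠ 0 := by rintro rfl; norm_num at e1
    have e2 : n' = 0 := by
      have : m' ^ 2 * n' = 0 := by linear_combination a3
      simpa [hm'] using this
    subst e2
    exact ⟨rfl, rfl, by linear_combination a2, e1⟩
  by_cases hn : n = 0
  · right
    subst hn
    have e1 : n' ^ 3 = -1 := by linear_combination a2
    have hn' : n' ≠ 0 := by rintro rfl; norm_num at e1
    have e2 : m' = 0 := by
      have : m' * n' ^ 2 = 0 := by linear_combination a4
      simpa [hn'] using this
    subst e2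
    exact ⟨rfl, rfl, by linear_combination a1, e1⟩
  exfalso
  have hm' : m' ≠ 0 := by
    rintro rfl
    have : m ^ 2 * n = 0 := by linear_combination a3
    simp [hm, hn] at this
  have hn' : n' ≠ 0 := by
    rintro rfl
    have : m ^ 2 * n = 0 := by linear_combination a3
    simp [hm, hn] at this
  have e : m * n' - m' * n = 0 := by
    have : (m * n * m' * n') * (m * n' - m' * n) = 0 := by
      linear_combination m' * n' ^ 2 * a3 - m' ^ 2 * n' * a4
    exact (mul_eq_zero.1 this).resolve_left (by simp [hm, hn, hm', hn'])
  have : n = 0 := by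
    -- multiply the first cubic relation by `n`
    linear_combination n * a1 - m * a3 + m' ^ 2 * e
  exact hn this

/-- A line on the cubic, written by two of its equations. -/
theorem line_lemma {K : Type} [Field K] [CharZero K] (c d : Fin 4 → K) (k l : Fin 4)
    (hD : c k * d l - c l * d k ≠ 0)
    (H : ∀ x : Fin 4 → K, ∑ i, c i * x i = 0 → ∑ i, d i * x i = 0 → ∑ i, x i ^ 3 = 0) :
    ∃ (k u l v : Fin 4) (a b : K), [k, u, l, v].Nodup ∧ a ^ 3 = -1 ∧ b ^ 3 = -1 ∧
      (∃ α β : K, (X k - C a * X u : S K)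
        = C α * (∑ i, C (c i) * X i) + C β * (∑ i, C (d i) * X i)) ∧
      (∃ α β : K, (X l - C b * X v : S K)
        = C α * (∑ i, C (c i) * X i) + C β * (∑ i, C (d i) * X i)) := by
  have hkl : k ≠ l := by rintro rfl; exact hD (by ring)
  obtain ⟨u, v, hn⟩ : ∃ u v : Fin 4, [k, l, u, v].Nodup := by
    clear hD H; revert k l; decide
  have hn' := hn
  simp only [List.nodup_cons, List.mem_cons, List.not_mem_nil, or_false, not_or] at hn'
  obtain ⟨⟨h1, h2, h3⟩, ⟨h4, h5⟩, h6, -⟩ := hn'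
  obtain ⟨D, hDe⟩ : ∃ D, D = c k * d l - c l * d k := ⟨_, rfl⟩
  rw [← hDe] at hD
  obtain ⟨m, hm⟩ : ∃ m, m = (c l * d u - c u * d l) / D := ⟨_, rfl⟩
  obtain ⟨n, hnn⟩ : ∃ n, n = (c l * d v - c v * d l) / D := ⟨_, rfl⟩
  obtain ⟨m', hm'⟩ : ∃ m, m = (c u * d k - c k * d u) / D := ⟨_, rfl⟩
  obtain ⟨n', hn'⟩ : ∃ n, n = (c v * d k - c k * d v) / D := ⟨_, rfl⟩
  have key : ∀ x y : K,
      (m * x + n * y) ^ 3 + (m' * x + n' * y) ^ 3 + x ^ 3 + y ^ 3 = 0 := by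
    intro x y
    have := H (fun i => if i = k then m * x + n * y else
      if i = l then m' * x + n' * y else if i = u then x else y)
    rw [sum_four hn, sum_four hn, sum_four hn] at this
    simp only [if_true, Ne.symm h1, Ne.symm h2, Ne.symm h3, Ne.symm h4, Ne.symm h5, Ne.symm h6,
      if_false] at this
    refine this ?_ ?_
    · rw [hm, hm', hnn, hn']; field_simp; rw [hDe]; ring
    · rw [hm, hm', hnn, hn']; field_simp; rw [hDe]; ring
  have E1 : (X k - C m * X u - C n * X v : S K)
        = C (d l / D) * (∑ i, C (c i) * X i) + C (-(c l / D)) * (∑ i, C (d i) * X i) := by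
    have t1 : d l / D * c k + -(c l / D) * d k = 1 := by
      field_simp; rw [hDe]; ring
    have t2 : d l / D * c l + -(c l / D) * d l = 0 := by ring
    have t3 : d l / D * c u + -(c l / D) * d u = -m := by rw [hm]; ring
    have t4 : d l / D * c v + -(c l / D) * d v = -n := by rw [hnn]; ring
    rw [sum_four hn, sum_four hn]
    have s1 := congrArg (C : K → S K) t1
    have s2 := congrArg (C : K → S K) t2
    have s3 := congrArg (C : K → S K) t3
    have s4 := congrArg (C : K → S K) t4
    simp only [map_add, map_mul, map_neg, map_one, map_zero] at s1 s2 s3 s4 ⊢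
    linear_combination -X k * s1 - X l * s2 - X u * s3 - X v * s4
  have E2 : (X l - C m' * X u - C n' * X v : S K)
        = C (-(d k / D)) * (∑ i, C (c i) * X i) + C (c k / D) * (∑ i, C (d i) * X i) := by
    have t1 : -(d k / D) * c k + c k / D * d k = 0 := by ring
    have t2 : -(d k / D) * c l + c k / D * d l = 1 := by
      field_simp; rw [hDe]; ring
    have t3 : -(d k / D) * c u + c k / D * d u = -m' := by rw [hm']; ring
    have t4 : -(d k / D) * c v + c k / D * d v = -n' := by rw [hn']; ring
    rw [sum_four hn, sum_four hn]
    have s1 := congrArg (C : K → S K) t1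
    have s2 := congrArg (C : K → S K) t2
    have s3 := congrArg (C : K → S K) t3
    have s4 := congrArg (C : K → S K) t4
    simp only [map_add, map_mul, map_neg, map_one, map_zero] at s1 s2 s3 s4 ⊢
    linear_combination -X k * s1 - X l * s2 - X u * s3 - X v * s4
  rcases line_algebra m n m' n' key with ⟨z1, z2, z3, z4⟩ | ⟨z1, z2, z3, z4⟩
  · refine ⟨k, v, l, u, n, m', ?_, z3, z4,
      ⟨d l / D, -(c l / D), ?_⟩, ⟨-(d k / D), c k / D, ?_⟩⟩
    · clear * - hn; revert k l u v; decide
    · rw [← E1, z1]; simp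
    · rw [← E2, z2]; simp
  · refine ⟨k, u, l, v, m, n', ?_, z3, z4,
      ⟨d l / D, -(c l / D), ?_⟩, ⟨-(d k / D), c k / D, ?_⟩⟩
    · clear * - hn; revert k l u v; decide
    · rw [← E1, z1]; simp
    · rw [← E2, z2]; simp

theorem flip_pair {K : Type} [Field K] {p r : S K} {k u : Fin 4} {a : K} (ha : a ^ 3 = -1)
    (h : ∃ α β : K, (X k - C a * X u : S K) = C α * p + C β * r) :
    ∃ a' : K, a' ^ 3 = -1 ∧ ∃ α β : K, (X u - C a' * X k : S K) = C α * p + C β * r := by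
  have h0 : a ≠ 0 := by rintro rfl; norm_num at ha
  obtain ⟨α, β, h⟩ := h
  refine ⟨a⁻¹, by rw [inv_pow, ha]; norm_num, -a⁻¹ * α, -a⁻¹ * β, ?_⟩
  have : (C a⁻¹ * C a : S K) = 1 := by rw [← C_mul, inv_mul_cancel₀ h0, C_1]
  simp only [map_mul, map_neg]
  linear_combination (-C a⁻¹) * h - X u * this

/-- Normal form of the equations of a line on the cubic. -/
theorem line_normal {K : Type} [Field K] {p r : S K}
    (h : ∃ (k u l v : Fin 4) (a b : K), [k, u, l, v].Nodup ∧ a ^ 3 = -1 ∧ b ^ 3 = -1 ∧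
      (∃ α β : K, (X k - C a * X u : S K) = C α * p + C β * r) ∧
      (∃ α β : K, (X l - C b * X v : S K) = C α * p + C β * r)) :
    ∃ (s i j : Fin 4) (a b : K), [0, s, i, j].Nodup ∧ i < j ∧ a ^ 3 = -1 ∧ b ^ 3 = -1 ∧
      (∃ α β : K, (X 0 - C a * X s : S K) = C α * p + C β * r) ∧
      (∃ α β : K, (X i - C b * X j : S K) = C α * p + C β * r) := by
  obtain ⟨k, u, l, v, a, b, hn, ha, hb, h1, h2⟩ := h
  obtain ⟨a', ha', h1'⟩ := flip_pair ha h1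
  obtain ⟨b', hb', h2'⟩ := flip_pair hb h2
  have hc : (k = 0 ∧ l < v) ∨ (k = 0 ∧ v < l) ∨ (u = 0 ∧ l < v) ∨ (u = 0 ∧ v < l) ∨
      (l = 0 ∧ k < u) ∨ (l = 0 ∧ u < k) ∨ (v = 0 ∧ k < u) ∨ (v = 0 ∧ u < k) := by
    clear * - hn; revert k u l v; decide
  rcases hc with ⟨rfl, q⟩ | ⟨rfl, q⟩ | ⟨rfl, q⟩ | ⟨rfl, q⟩ | ⟨rfl, q⟩ | ⟨rfl, q⟩ | ⟨rfl, q⟩ | ⟨rfl, q⟩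
  · exact ⟨u, l, v, a, b, by clear * - hn; revert u l v; decide, q, ha, hb, h1, h2⟩
  · exact ⟨u, v, l, a, b', by clear * - hn; revert u l v; decide, q, ha, hb', h1, h2'⟩
  · exact ⟨k, l, v, a', b, by clear * - hn; revert k l v; decide, q, ha', hb, h1', h2⟩
  · exact ⟨k, v, l, a', b', by clear * - hn; revert k l v; decide, q, ha', hb', h1', h2'⟩
  · exact ⟨v, k, u, b, a, by clear * - hn; revert k u v; decide, q, hb, ha, h2, h1⟩
  · exact ⟨v, u, k, b, a', by clear * - hn; revert k u v; decide, q, hb, ha', h2, h1'⟩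
  · exact ⟨l, k, u, b', a, by clear * - hn; revert k u l; decide, q, hb', ha, h2', h1⟩
  · exact ⟨l, u, k, b', a', by clear * - hn; revert k u l; decide, q, hb', ha', h2', h1'⟩

theorem Yv_succ (K : Type) [Field K] (i : Fin 4) : Yv K (i.val + 1) = X i := by
  fin_cases i <;> rfl

theorem lin_prime {K : Type} [Field K] (a : K) {s : Fin 4} (hs : (0 : Fin 4) ≠ s) :
    Prime (X 0 - C a * X s : S K) := by
  have h := irreducible_mul_X_add (1 : S K) (-(C a * X s)) 0 one_ne_zero (by simp)
    (by
      rw [vars_neg]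
      intro h
      have h' := vars_mul _ _ h
      simp at h'
      exact hs h') isRelPrime_one_left
  rw [one_mul, ← sub_eq_add_neg] at h
  exact h.prime

/-- The predicate that `M` is equivalent to one of the matrices `φ_ij(a,b)`. -/
def Good (K : Type) [Field K] (M : Matrix (Fin 2) (Fin 2) (S K)) : Prop :=
  ∃ (a b : K) (i j s : ℕ), a ^ 3 = -1 ∧ b ^ 3 = -1 ∧
      ({i, j, s} : Finset ℕ) = {2, 3, 4} ∧ i < j ∧ Eqv K M (phiM K a b i j s)

theorem core {K : Type} [Field K] [CharZero K] (p q r t : S K) (c : K) (hc : c ≠ 0)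
    (hp : p.IsHomogeneous 1) (hr : r.IsHomogeneous 1) (hq : eval 0 q = 0) (ht : eval 0 t = 0)
    (h : p * t - q * r = C c * f4 K) : Good K !![p, q; r, t] := by
  have hp0 : eval 0 p = 0 := eval_zero_of_hom one_pos hp
  have hr0 : eval 0 r = 0 := eval_zero_of_hom one_pos hr
  obtain ⟨x, hx⟩ := lin_form hp
  obtain ⟨y, hy⟩ := lin_form hr
  have hind : ∃ k l, x k * y l - x l * y k ≠ 0 := by
    by_contra! hall
    have hxne : ∃ k, x k ≠ 0 := by
      by_contra! h0
      have : p = 0 := by rw [hx]; simp [h0]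
      refine no_prod (p := -q) (q := r) hc (by rw [map_neg, hq, neg_zero]) hr0 ?_
      rw [← h, this]; ring
    obtain ⟨k, hk⟩ := hxne
    have hry : r = C (y k / x k) * p := by
      rw [hy, hx, Finset.mul_sum]
      refine Finset.sum_congr rfl fun l _ => ?_
      rw [← mul_assoc, ← C_mul]
      congr 2
      field_simp
      linear_combination hall k l
    refine no_prod (p := p) (q := t - C (y k / x k) * q) hc hp0 (by rw [map_sub, map_mul, hq, ht, mul_zero, sub_zero]) ?_
    rw [← h, hry]; ring
  obtain ⟨k, l, hD⟩ := hind
  have hline := line_lemma x y k l hD (by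
    intro z h1 h2
    have e1 : eval z p = 0 := by rw [hx]; simpa using h1
    have e2 : eval z r = 0 := by rw [hy]; simpa using h2
    have := congrArg (eval z) h
    rw [f4_eq] at this
    simp only [map_sub, map_mul, e1, e2, eval_C, zero_mul, mul_zero, sub_zero] at this
    have := (mul_eq_zero.1 this.symm).resolve_left hc
    simpa using this)
  rw [← hx, ← hy] at hline
  obtain ⟨s, i, j, a, b, hn, hij, ha, hb, ⟨α, β, h1⟩, ⟨γ, δ, h2⟩⟩ := line_normal hline
  have hn' := hn
  simp only [List.nodup_cons, List.mem_cons, List.not_mem_nil, or_false, not_or] at hn'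
  obtain ⟨⟨g1, g2, g3⟩, ⟨g4, g5⟩, g6, -⟩ := hn'
  have hf : f4 K = X 0 ^ 3 + X s ^ 3 + X i ^ 3 + X j ^ 3 := by
    rw [f4_eq, sum_four hn]
  -- evaluations at the coordinate points
  have v1 : eval (Pi.single (0 : Fin 4) (1 : K)) (X 0 - C a * X s : S K) = 1 := by
    simp [Ne.symm g1]
  have v2 : eval (Pi.single (0 : Fin 4) (1 : K)) (X i - C b * X j : S K) = 0 := by
    simp [Ne.symm g2, Ne.symm g3]
  have v3 : eval (Pi.single i (1 : K)) (X 0 - C a * X s : S K) = 0 := by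
    simp [g2, g4]
  have v4 : eval (Pi.single i (1 : K)) (X i - C b * X j : S K) = 1 := by
    simp [Ne.symm g6]
  have hΔ : α * δ - β * γ ≠ 0 := by
    intro h0
    have z0 : (C α * C δ - C β * C γ : S K) = 0 := by
      rw [← C_mul, ← C_mul, ← C_sub, h0, C_0]
    have r1 : C δ * (X 0 - C a * X s : S K) - C β * (X i - C b * X j) = 0 := by
      rw [h1, h2]; linear_combination p * z0
    have r2 : C γ * (X 0 - C a * X s : S K) - C α * (X i - C b * X j) = 0 := by
      rw [h1, h2]; linear_combination -r * z0
    have w1 := congrArg (eval (Pi.single i (1 : K))) r1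
    have w2 := congrArg (eval (Pi.single i (1 : K))) r2
    simp only [map_sub (eval _) (C _ * _), map_mul, v3, v4, eval_C, map_zero, mul_zero, mul_one,
      zero_sub, neg_eq_zero] at w1 w2
    rw [w1, w2] at h1
    rw [h1] at v1
    simp at v1
  have hs0 : (0 : Fin 4) ≠ s := g1
  have hprime := lin_prime a hs0
  obtain ⟨A, hA⟩ : ∃ A : S K, A = X 0 ^ 2 + C a * X 0 * X s + C a ^ 2 * X s ^ 2 := ⟨_, rfl⟩
  obtain ⟨B, hB⟩ : ∃ B : S K, B = X i ^ 2 + C b * X i * X j + C b ^ 2 * X j ^ 2 := ⟨_, rfl⟩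
  have hphi : phiM K a b (i.val + 1) (j.val + 1) (s.val + 1)
      = !![X 0 - C a * X s, -B; X i - C b * X j, A] := by
    simp only [phiM, Yv_succ, hA, hB]
    rfl
  have ha' : (C a : S K) ^ 3 = -1 := by rw [← C_pow, ha]; simp
  have hb' : (C b : S K) ^ 3 = -1 := by rw [← C_pow, hb]; simp
  have hAB : (X 0 - C a * X s) * A + (X i - C b * X j) * B = f4 K := by
    rw [hf, hA, hB]
    linear_combination -X s ^ 3 * ha' - X j ^ 3 * hb'
  obtain ⟨ℓ, hℓ⟩ : ∃ ℓ : S K, ℓ = X 0 - C a * X s := ⟨_, rfl⟩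
  obtain ⟨ℓ', hℓ'⟩ : ∃ ℓ : S K, ℓ = X i - C b * X j := ⟨_, rfl⟩
  rw [← hℓ, ← hℓ'] at hphi hAB
  rw [← hℓ] at h1 hprime v1 v3
  rw [← hℓ'] at h2 v2 v4
  obtain ⟨e, he⟩ : ∃ e : K, e = (α * δ - β * γ) * c := ⟨_, rfl⟩
  have he0 : e ≠ 0 := by rw [he]; exact mul_ne_zero hΔ hc
  have hCe : (C e : S K) = (C α * C δ - C β * C γ) * C c := by
    rw [he]; simp
  have hrel : ℓ * ((C γ * q + C δ * t) - C e * A) = ℓ' * ((C α * q + C β * t) + C e * B) := by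
    have : ℓ * (C γ * q + C δ * t) - ℓ' * (C α * q + C β * t) = C e * f4 K := by
      rw [h1, h2, hCe]; linear_combination (C α * C δ - C β * C γ) * h
    linear_combination this - C e * hAB
  have hdvd : ℓ ∣ (C α * q + C β * t) + C e * B := by
    refine (hprime.dvd_or_dvd (Dvd.intro _ hrel)).resolve_left ?_
    rintro ⟨w, hw⟩
    rw [hw] at v4
    simp [v3] at v4
  obtain ⟨g, hg⟩ := hdvd
  have hg2 : (C γ * q + C δ * t) - C e * A = ℓ' * g := by
    refine mul_left_cancel₀ hprime.ne_zero ?_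
    rw [hrel, hg]; ring
  have hinv : (C e⁻¹ * C e : S K) = 1 := by rw [← C_mul, inv_mul_cancel₀ he0, C_1]
  refine ⟨a, b, i.val + 1, j.val + 1, s.val + 1, ha, hb, ?_, ?_, ?_⟩
  · clear * - hn; revert i j s; decide
  · simpa using hij
  · rw [hphi]
    refine ⟨!![C α, C β; C γ, C δ], !![1, -g * C e⁻¹; 0, C e⁻¹], ?_, ?_, ?_⟩
    · rw [Matrix.det_fin_two_of, ← C_mul, ← C_mul, ← C_sub]
      exact (IsUnit.mk0 _ hΔ).map C
    · rw [Matrix.det_fin_two_of]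
      simp only [one_mul, mul_zero, sub_zero]
      exact (IsUnit.mk0 _ (inv_ne_zero he0)).map C
    · rw [Matrix.mul_fin_two, Matrix.mul_fin_two]
      have m1 : (C α * p + C β * r) * 1 + (C α * q + C β * t) * 0 = ℓ := by rw [h1]; ring
      have m2 : (C α * p + C β * r) * (-g * C e⁻¹) + (C α * q + C β * t) * C e⁻¹ = -B := by
        rw [← h1]; linear_combination C e⁻¹ * hg - B * hinv
      have m3 : (C γ * p + C δ * r) * 1 + (C γ * q + C δ * t) * 0 = ℓ' := by rw [h2]; ring
      have m4 : (C γ * p + C δ * r) * (-g * C e⁻¹) + (C γ * q + C δ * t) * C e⁻¹ = A := by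
        rw [← h2]; linear_combination C e⁻¹ * hg2 + A * hinv
      rw [m1, m2, m3, m4]

theorem deg_three {K : Type} [Field K] [CharZero K] {A B : S K} {m n : ℕ} {c : K} (hc : c ≠ 0)
    (hA : A.IsHomogeneous m) (hB : B.IsHomogeneous n) (h : A + B = C c * f4 K)
    (hB' : B ≠ C c * f4 K) : m = 3 := by
  by_contra hm
  have h3 := congrArg (homogeneousComponent 3) h
  have hf : (C c * f4 K).IsHomogeneous 3 := (f4_hom K).C_mul c
  rw [map_add, homogeneousComponent_of_mem hA, homogeneousComponent_of_mem hB,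
    homogeneousComponent_eq_self hf, if_neg (Ne.symm hm), zero_add] at h3
  split_ifs at h3 with hn
  · exact hB' h3
  · rcases mul_eq_zero.1 h3.symm with h' | h'
    · exact hc (by simpa using h')
    · exact f4_ne K h'

theorem det_eq {K : Type} [Field K] [CharZero K] (φ ψ : Matrix (Fin 2) (Fin 2) (S K))
    (hφ : eval 0 φ.det = 0) (hψ : eval 0 ψ.det = 0)
    (h1 : φ * ψ = f4 K • (1 : Matrix (Fin 2) (Fin 2) (S K))) :
    ∃ c : K, c ≠ 0 ∧ φ.det = C c * f4 K := by
  have hd : φ.det * ψ.det = f4 K * f4 K := by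
    rw [← Matrix.det_mul, h1, Matrix.det_smul]; simp [pow_two]
  have hirr := f4_irreducible K
  have hu : ∀ g : S K, IsUnit g → ∃ c : K, c ≠ 0 ∧ g = C c := by
    intro g hg
    obtain ⟨h, h'⟩ := MvPolynomial.isUnit_iff_totalDegree_of_isReduced.mp hg
    rw [totalDegree_eq_zero_iff_eq_C] at h'
    exact ⟨_, h.ne_zero, h'⟩
  rcases hirr.prime.dvd_or_dvd (Dvd.intro _ hd.symm) with ⟨g, hg⟩ | ⟨g, hg⟩
  · have : f4 K = g * ψ.det := by
      refine mul_left_cancel₀ hirr.ne_zero ?_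
      rw [← hd, hg]; ring
    obtain ⟨c, hc, rfl⟩ := hu g
      ((hirr.isUnit_or_isUnit this).resolve_right (not_unit_of_eval hψ))
    exact ⟨c, hc, by rw [hg, mul_comm]⟩
  · have : f4 K = φ.det * g := by
      refine mul_left_cancel₀ hirr.ne_zero ?_
      rw [← hd, hg]; ring
    obtain ⟨c, hc, rfl⟩ := hu g
      ((hirr.isUnit_or_isUnit this).resolve_left (not_unit_of_eval hφ))
    refine ⟨c⁻¹, inv_ne_zero hc, ?_⟩
    rw [this, mul_comm, mul_assoc, ← C_mul, mul_inv_cancel₀ hc, C_1, mul_one]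

theorem Good.of_eqv {K : Type} [Field K] {M N : Matrix (Fin 2) (Fin 2) (S K)}
    (h : Eqv K M N) (hN : Good K N) : Good K M := by
  obtain ⟨a, b, i, j, s, ha, hb, hs, hij, he⟩ := hN
  exact ⟨a, b, i, j, s, ha, hb, hs, hij, h.trans he⟩

theorem good_or {K : Type} [Field K] [CharZero K] (p q r t : S K) (c : K) (hc : c ≠ 0)
    (hp : ∃ d : ℕ, 0 < d ∧ p.IsHomogeneous d) (hq : ∃ d : ℕ, 0 < d ∧ q.IsHomogeneous d)
    (hr : ∃ d : ℕ, 0 < d ∧ r.IsHomogeneous d) (ht : ∃ d : ℕ, 0 < d ∧ t.IsHomogeneous d)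
    (h : p * t - q * r = C c * f4 K) :
    Good K !![p, q; r, t] ∨ Good K !![p, q; r, t]ᵀ := by
  obtain ⟨dp, dp0, hp⟩ := hp
  obtain ⟨dq, dq0, hq⟩ := hq
  obtain ⟨dr, dr0, hr⟩ := hr
  obtain ⟨dt, dt0, ht⟩ := ht
  have ep := eval_zero_of_hom dp0 hp
  have eq := eval_zero_of_hom dq0 hq
  have er := eval_zero_of_hom dr0 hr
  have et := eval_zero_of_hom dt0 ht
  have n1 : dp + dt = 3 := by
    refine deg_three hc (hp.mul ht) (hq.mul hr).neg (by rw [← h]; ring) ?_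
    rw [← neg_mul]
    exact no_prod hc (by rw [map_neg, eq, neg_zero]) er
  have n2 : dq + dr = 3 := by
    refine deg_three hc (hq.mul hr).neg (hp.mul ht) (by rw [← h]; ring) ?_
    exact no_prod hc ep et
  have hT : ∀ p q r t : S K, !![p, q; r, t]ᵀ = !![p, r; q, t] := by
    intro p q r t
    ext x y
    fin_cases x <;> fin_cases y <;> rfl
  have hc' : -c ≠ 0 := neg_ne_zero.2 hc
  rw [hT]
  have : (dp = 1 ∨ dt = 1) ∧ (dq = 1 ∨ dr = 1) := by omega
  obtain ⟨rfl | rfl, rfl | rfl⟩ := this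
  · right
    exact core p r q t c hc hp hq er et (by rw [← h]; ring)
  · left
    exact core p q r t c hc hp hr eq et h
  · left
    refine Good.of_eqv (swap_eqv K p q r t) (core q p t r (-c) hc' hq ht ep er ?_)
    rw [map_neg]; linear_combination -h
  · right
    refine Good.of_eqv (swap_eqv K p r q t) (core r p t q (-c) hc' hr ht ep eq ?_)
    rw [map_neg]; linear_combination -h

theorem stmt1 (K : Type) [Field K] [IsAlgClosed K] [CharZero K]
    (φ ψ : Matrix (Fin 2) (Fin 2) (S K))
    (hφ : ∀ k l, ∃ d : ℕ, 0 < d ∧ (φ k l).IsHomogeneous d)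
    (hψ : ∀ k l, ∃ d : ℕ, 0 < d ∧ (ψ k l).IsHomogeneous d)
    (h1 : φ * ψ = f4 K • (1 : Matrix (Fin 2) (Fin 2) (S K)))
    (h2 : ψ * φ = f4 K • (1 : Matrix (Fin 2) (Fin 2) (S K))) :
    ∃ (a b : K) (i j s : ℕ), a ^ 3 = -1 ∧ b ^ 3 = -1 ∧
      ({i, j, s} : Finset ℕ) = {2, 3, 4} ∧ i < j ∧
      (Nonempty (coker K φ ≃ₗ[R4 K] coker K (phiM K a b i j s)) ∨
        Nonempty (coker K φ ≃ₗ[R4 K] coker K (psiM K a b i j s))) := by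
  have ez : ∀ M : Matrix (Fin 2) (Fin 2) (S K),
      (∀ k l, ∃ d : ℕ, 0 < d ∧ (M k l).IsHomogeneous d) → eval 0 M.det = 0 := by
    intro M hM
    have e : ∀ k l, eval 0 (M k l) = 0 := by
      intro k l
      obtain ⟨d, d0, hd⟩ := hM k l
      exact eval_zero_of_hom d0 hd
    rw [Matrix.det_fin_two]
    simp only [map_sub, map_mul, e, mul_zero, sub_zero]
  obtain ⟨c, hc, hdet⟩ := det_eq φ ψ (ez φ hφ) (ez ψ hψ) h1
  rw [Matrix.det_fin_two] at hdet
  have hgood := good_or (φ 0 0) (φ 0 1) (φ 1 0) (φ 1 1) c hc (hφ _ _) (hφ _ _) (hφ _ _) (hφ _ _)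
    hdet
  rw [← Matrix.eta_fin_two φ] at hgood
  rcases hgood with hg | hg
  · obtain ⟨a, b, i, j, s, ha, hb, hs, hij, he⟩ := hg
    exact ⟨a, b, i, j, s, ha, hb, hs, hij, Or.inl he.coker_equiv⟩
  · obtain ⟨a, b, i, j, s, ha, hb, hs, hij, he⟩ := hg
    have he' := he.transpose.trans (phi_transpose_eqv_psi K a b i j s)
    rw [Matrix.transpose_transpose] at he'
    exact ⟨a, b, i, j, s, ha, hb, hs, hij, Or.inr he'.coker_equiv⟩
end
end

section
/- If Coker φ_ij(a,b) ≅ Coker φ_uv(a',b') as R₄-modules then (i,j,a,b) = (u,v,a',b'); if Coker ψ_ij(a,b) ≅ Coker ψ_uv(a',b') then (i,j,a,b) = (u,v,a',b'); and for no choice of parameters is Coker φ_ij(a,b) isomorphic to Coker ψ_uv(a',b'). In other words, the R₄-modules Coker φ_ij(a,b) and Coker ψ_ij(a,b), over all admissible parameters, are pairwise non-isomorphic. -/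
open MvPolynomial Matrix TensorProduct

set_option maxHeartbeats 1000000
set_option synthInstance.maxHeartbeats 400000

noncomputable section

/-- The directional derivative at the origin. -/
def Dlin (K : Type) [Field K] (p : Fin 4 → K) (g : S K) : K :=
  ∑ k, p k * constantCoeff (pderiv k g)

lemma Dlin_add (K : Type) [Field K] (p : Fin 4 → K) (g h : S K) :
    Dlin K p (g + h) = Dlin K p g + Dlin K p h := by
  simp [Dlin, mul_add, Finset.sum_add_distrib]

lemma Dlin_neg (K : Type) [Field K] (p : Fin 4 → K) (g : S K) :
    Dlin K p (-g) = - Dlin K p g := by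
  simp [Dlin]

lemma Dlin_sub (K : Type) [Field K] (p : Fin 4 → K) (g h : S K) :
    Dlin K p (g - h) = Dlin K p g - Dlin K p h := by
  rw [sub_eq_add_neg, Dlin_add, Dlin_neg, sub_eq_add_neg]

lemma Dlin_mul (K : Type) [Field K] (p : Fin 4 → K) (g h : S K) :
    Dlin K p (g * h) = constantCoeff g * Dlin K p h + constantCoeff h * Dlin K p g := by
  simp only [Dlin, Finset.mul_sum, ← Finset.sum_add_distrib]
  refine Finset.sum_congr rfl fun k _ => ?_
  simp only [Derivation.leibniz, smul_eq_mul, map_add, map_mul]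
  ring

lemma Dlin_C (K : Type) [Field K] (p : Fin 4 → K) (c : K) : Dlin K p (C c) = 0 := by
  simp [Dlin]

lemma eval_Yv (K : Type) [Field K] (n : ℕ) : constantCoeff (Yv K n) = 0 := by
  unfold Yv
  split <;> simp

lemma Dlin_Yv (K : Type) [Field K] (p : Fin 4 → K) (n : ℕ) :
    Dlin K p (Yv K n) = eval p (Yv K n) := by
  unfold Yv
  split <;> simp [Dlin, pderiv_X, Pi.single_apply]

lemma lift_iso {R : Type*} [CommRing R] {n : ℕ} (A B : Matrix (Fin n) (Fin n) R)
    (e : ((Fin n → R) ⧸ LinearMap.range A.mulVecLin) ≃ₗ[R]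
      ((Fin n → R) ⧸ LinearMap.range B.mulVecLin)) :
    ∃ U U' V W : Matrix (Fin n) (Fin n) R, U * A = B * V ∧ U' * U = 1 + A * W := by
  set P := LinearMap.range A.mulVecLin with hP
  set Q := LinearMap.range B.mulVecLin with hQ
  obtain ⟨u, hu⟩ := Module.projective_lifting_property Q.mkQ
    (e.toLinearMap ∘ₗ P.mkQ) Q.mkQ_surjective
  obtain ⟨u', hu'⟩ := Module.projective_lifting_property P.mkQ
    (e.symm.toLinearMap ∘ₗ Q.mkQ) P.mkQ_surjective
  have hu2 : ∀ x, Q.mkQ (u x) = e (P.mkQ x) := fun x => LinearMap.congr_fun hu x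
  have hu2' : ∀ x, P.mkQ (u' x) = e.symm (Q.mkQ x) := fun x => LinearMap.congr_fun hu' x
  have key : ∀ (M : Matrix (Fin n) (Fin n) R) (g : (Fin n → R) →ₗ[R] (Fin n → R)),
      (∀ x, g x ∈ LinearMap.range M.mulVecLin) →
      ∃ V : Matrix (Fin n) (Fin n) R, g.toMatrix' = M * V := by
    intro M g hg
    obtain ⟨v, hv⟩ := Module.projective_lifting_property M.mulVecLin.rangeRestrict
      (g.codRestrict _ hg) M.mulVecLin.surjective_rangeRestrict
    refine ⟨v.toMatrix', ?_⟩
    have : g = M.mulVecLin ∘ₗ v := by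
      ext1 x
      ext1
      exact (congrArg Subtype.val (LinearMap.congr_fun hv (Pi.single x 1))).symm
    rw [this, LinearMap.toMatrix'_comp, ← Matrix.toLin'_apply', LinearMap.toMatrix'_toLin']
  obtain ⟨V, hV⟩ := key B (u ∘ₗ A.mulVecLin) (by
    intro x
    rw [← hQ, ← Submodule.Quotient.mk_eq_zero, ← Submodule.mkQ_apply, LinearMap.comp_apply, hu2]
    have : P.mkQ (A.mulVecLin x) = 0 := by
      rw [Submodule.mkQ_apply, Submodule.Quotient.mk_eq_zero]
      exact ⟨x, rfl⟩
    rw [this, map_zero])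
  obtain ⟨W, hW⟩ := key A (u' ∘ₗ u - LinearMap.id) (by
    intro x
    rw [← hP, ← Submodule.Quotient.mk_eq_zero, ← Submodule.mkQ_apply, LinearMap.sub_apply,
      map_sub, LinearMap.comp_apply, hu2', hu2]
    simp)
  refine ⟨u.toMatrix', u'.toMatrix', V, W, ?_, ?_⟩
  · rw [← hV, LinearMap.toMatrix'_comp, ← Matrix.toLin'_apply', LinearMap.toMatrix'_toLin']
  · rw [← hW, map_sub, LinearMap.toMatrix'_comp, LinearMap.toMatrix'_id]
    abel

lemma Dlin_f4 (K : Type) [Field K] (p : Fin 4 → K) : Dlin K p (f4 K) = 0 := by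
  simp [f4, Dlin_add, pow_succ, Dlin_mul, eval_Yv]

lemma eval_f4 (K : Type) [Field K] : constantCoeff (f4 K) = 0 := by
  simp [f4, eval_Yv]

lemma lift_mat (K : Type) [Field K] {n : ℕ} (U : Matrix (Fin n) (Fin n) (R4 K)) :
    ∃ U1 : Matrix (Fin n) (Fin n) (S K), U1.map (proj K) = U := by
  choose g hg using fun x y => Ideal.Quotient.mk_surjective (U x y)
  exact ⟨Matrix.of g, by ext x y; simp [hg]⟩

lemma proj_eq (K : Type) [Field K] {n : ℕ} {U V : Matrix (Fin n) (Fin n) (S K)}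
    (h : U.map (proj K) = V.map (proj K)) (x y : Fin n) :
    constantCoeff (U x y) = constantCoeff (V x y) ∧
      ∀ p, Dlin K p (U x y) = Dlin K p (V x y) := by
  have h1 : proj K (U x y) = proj K (V x y) := congrFun (congrFun h x) y
  rw [Ideal.Quotient.eq, Ideal.mem_span_singleton] at h1
  obtain ⟨c, hc⟩ := h1
  rw [sub_eq_iff_eq_add] at hc
  refine ⟨by rw [hc]; simp [eval_f4], fun p => ?_⟩
  rw [hc, Dlin_add, Dlin_mul, Dlin_f4, eval_f4]
  simp

lemma key_lin (K : Type) [Field K] (A B : Matrix (Fin 2) (Fin 2) (S K))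
    (hA : ∀ x y, constantCoeff (A x y) = 0) (hB : ∀ x y, constantCoeff (B x y) = 0)
    (e : coker K A ≃ₗ[R4 K] coker K B) :
    ∃ U U' V : Matrix (Fin 2) (Fin 2) K, U' * U = 1 ∧
      ∀ p, U * (A.map (Dlin K p)) = (B.map (Dlin K p)) * V := by
  obtain ⟨U, U', V, W, h1, h2⟩ := lift_iso _ _ e
  obtain ⟨U, rfl⟩ := lift_mat K U
  obtain ⟨U', rfl⟩ := lift_mat K U'
  obtain ⟨V, rfl⟩ := lift_mat K V
  obtain ⟨W, rfl⟩ := lift_mat K W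
  have h1' : (U * A).map (proj K) = (B * V).map (proj K) := by
    rw [Matrix.map_mul, Matrix.map_mul, h1]
  have h2' : (U' * U).map (proj K) = (1 + A * W).map (proj K) := by
    rw [Matrix.map_mul, h2, Matrix.map_add _ (map_add _), Matrix.map_mul,
      Matrix.map_one _ (map_zero _) (map_one _)]
  refine ⟨U.map constantCoeff, U'.map constantCoeff, V.map constantCoeff, ?_, fun p => ?_⟩
  · rw [← Matrix.map_mul]
    ext x y
    have := (proj_eq K h2' x y).1
    rw [Matrix.map_apply, this]
    simp only [Matrix.add_apply, map_add, Matrix.mul_apply, map_sum, map_mul, hA]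
    by_cases hxy : x = y <;> simp [Matrix.one_apply, hxy]
  · ext x y
    have := (proj_eq K h1' x y).2 p
    simpa [Matrix.mul_apply, Fin.sum_univ_two, Dlin_add, Dlin_mul, hA, hB, mul_comm] using this

lemma D_phi (K : Type) [Field K] (a b : K) (i j s : ℕ) (p : Fin 4 → K) :
    (phiM K a b i j s).map (Dlin K p) =
      !![eval p (Yv K 1) - a * eval p (Yv K s), 0; eval p (Yv K i) - b * eval p (Yv K j), 0] := by
  ext x y
  fin_cases x <;> fin_cases y <;>
    simp [phiM, Dlin_add, Dlin_sub, Dlin_neg, pow_succ, Dlin_mul, Dlin_C, eval_Yv, Dlin_Yv]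

lemma D_psi (K : Type) [Field K] (a b : K) (i j s : ℕ) (p : Fin 4 → K) :
    (psiM K a b i j s).map (Dlin K p) =
      !![0, 0; -(eval p (Yv K i) - b * eval p (Yv K j)), eval p (Yv K 1) - a * eval p (Yv K s)] := by
  ext x y
  fin_cases x <;> fin_cases y <;>
    simp [psiM, Dlin_add, Dlin_sub, Dlin_neg, pow_succ, Dlin_mul, Dlin_C, eval_Yv, Dlin_Yv]

lemma E_phi (K : Type) [Field K] (a b : K) (i j s : ℕ) (x y : Fin 2) :
    constantCoeff (phiM K a b i j s x y) = 0 := by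
  fin_cases x <;> fin_cases y <;> simp [phiM, eval_Yv]

lemma E_psi (K : Type) [Field K] (a b : K) (i j s : ℕ) (x y : Fin 2) :
    constantCoeff (psiM K a b i j s x y) = 0 := by
  fin_cases x <;> fin_cases y <;> simp [psiM, eval_Yv]

lemma perm_cases (i j s : ℕ) (hperm : ({i, j, s} : Finset ℕ) = {2, 3, 4}) (hij : i < j) :
    (i = 2 ∧ j = 3 ∧ s = 4) ∨ (i = 2 ∧ j = 4 ∧ s = 3) ∨ (i = 3 ∧ j = 4 ∧ s = 2) := by
  have hi : i ∈ ({2, 3, 4} : Finset ℕ) := by rw [← hperm]; simp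
  have hj : j ∈ ({2, 3, 4} : Finset ℕ) := by rw [← hperm]; simp
  have hs : s ∈ ({2, 3, 4} : Finset ℕ) := by rw [← hperm]; simp
  have h2 : 2 ∈ ({i, j, s} : Finset ℕ) := by rw [hperm]; simp
  have h3 : 3 ∈ ({i, j, s} : Finset ℕ) := by rw [hperm]; simp
  have h4 : 4 ∈ ({i, j, s} : Finset ℕ) := by rw [hperm]; simp
  simp only [Finset.mem_insert, Finset.mem_singleton] at *
  omega

lemma line_eq (K : Type) [Field K] (a b a' b' : K) (ha' : a' ^ 3 = -1)
    (i j s u v w : ℕ)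
    (hperm : ({i, j, s} : Finset ℕ) = {2, 3, 4}) (hij : i < j)
    (hperm' : ({u, v, w} : Finset ℕ) = {2, 3, 4}) (huv : u < v)
    (h : ∀ p : Fin 4 → K, eval p (Yv K 1) - a' * eval p (Yv K w) = 0 →
      eval p (Yv K u) - b' * eval p (Yv K v) = 0 →
      eval p (Yv K 1) - a * eval p (Yv K s) = 0 ∧ eval p (Yv K i) - b * eval p (Yv K j) = 0) :
    i = u ∧ j = v ∧ a = a' ∧ b = b' := by
  have ha0 : a' ≠ 0 := by
    rintro rfl
    norm_num at ha'
  rcases perm_cases i j s hperm hij with ⟨rfl, rfl, rfl⟩ | ⟨rfl, rfl, rfl⟩ | ⟨rfl, rfl, rfl⟩ <;>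
  rcases perm_cases u v w hperm' huv with ⟨rfl, rfl, rfl⟩ | ⟨rfl, rfl, rfl⟩ | ⟨rfl, rfl, rfl⟩ <;>
  [have h1 := h ![a', 0, 0, 1]; have h1 := h ![a', 0, 1, 0]; have h1 := h ![a', 1, 0, 0];
   have h1 := h ![a', 0, 0, 1]; have h1 := h ![a', 0, 1, 0]; have h1 := h ![a', 1, 0, 0];
   have h1 := h ![a', 0, 0, 1]; have h1 := h ![a', 0, 1, 0]; have h1 := h ![a', 1, 0, 0]] <;>
  [have h2 := h ![0, b', 1, 0]; have h2 := h ![0, b', 0, 1]; have h2 := h ![0, 0, b', 1];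
   have h2 := h ![0, b', 1, 0]; have h2 := h ![0, b', 0, 1]; have h2 := h ![0, 0, b', 1];
   have h2 := h ![0, b', 1, 0]; have h2 := h ![0, b', 0, 1]; have h2 := h ![0, 0, b', 1]] <;>
  simp [Yv, ha0] at h1 h2 ⊢ <;>
  exact ⟨(sub_eq_zero.mp h1).symm, (sub_eq_zero.mp h2).symm⟩

lemma cancel_left {K : Type} [Field K] {U U' A : Matrix (Fin 2) (Fin 2) K} (h : U' * U = 1)
    (h0 : U * A = 0) : A = 0 := by
  rw [← Matrix.one_mul A, ← h, Matrix.mul_assoc, h0, Matrix.mul_zero]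

theorem stmt2 (K : Type) [Field K] [IsAlgClosed K] [CharZero K]
    (a b a' b' : K) (ha : a ^ 3 = -1) (hb : b ^ 3 = -1) (ha' : a' ^ 3 = -1) (hb' : b' ^ 3 = -1)
    (i j s u v w : ℕ)
    (hperm : ({i, j, s} : Finset ℕ) = {2, 3, 4}) (hij : i < j)
    (hperm' : ({u, v, w} : Finset ℕ) = {2, 3, 4}) (huv : u < v) :
    (Nonempty (coker K (phiM K a b i j s) ≃ₗ[R4 K] coker K (phiM K a' b' u v w)) →
      i = u ∧ j = v ∧ a = a' ∧ b = b') ∧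
    (Nonempty (coker K (psiM K a b i j s) ≃ₗ[R4 K] coker K (psiM K a' b' u v w)) →
      i = u ∧ j = v ∧ a = a' ∧ b = b') ∧
    ¬ Nonempty (coker K (phiM K a b i j s) ≃ₗ[R4 K] coker K (psiM K a' b' u v w)) := by
  refine ⟨?_, ?_, ?_⟩
  · rintro ⟨e⟩
    obtain ⟨U, U', V, hU, hD⟩ := key_lin K _ _ (E_phi K a b i j s) (E_phi K a' b' u v w) e
    refine line_eq K a b a' b' ha' i j s u v w hperm hij hperm' huv fun p h1 h2 => ?_
    have h := hD p
    rw [D_phi, D_phi, h1, h2] at h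
    have h0 := cancel_left hU (h.trans (by ext x y; fin_cases x <;> simp [Matrix.mul_apply, Fin.sum_univ_two]))
    have e1 := congrFun (congrFun h0 0) 0
    have e2 := congrFun (congrFun h0 1) 0
    exact ⟨by simpa using e1, by simpa using e2⟩
  · rintro ⟨e⟩
    obtain ⟨U, U', V, hU, hD⟩ := key_lin K _ _ (E_psi K a b i j s) (E_psi K a' b' u v w) e
    refine line_eq K a b a' b' ha' i j s u v w hperm hij hperm' huv fun p h1 h2 => ?_
    have h := hD p
    rw [D_psi, D_psi, h1, h2] at h
    have h0 := cancel_left hU (h.trans (by ext x y; fin_cases x <;> simp [Matrix.mul_apply, Fin.sum_univ_two]))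
    have e1 := congrFun (congrFun h0 1) 1
    have e2 := congrFun (congrFun h0 1) 0
    refine ⟨by simpa using e1, ?_⟩
    rw [← neg_eq_zero]
    exact e2
  · rintro ⟨e⟩
    obtain ⟨U, U', V, hU, hD⟩ := key_lin K _ _ (E_phi K a b i j s) (E_psi K a' b' u v w) e
    have h : ∀ p : Fin 4 → K, U 0 0 * (eval p (Yv K 1) - a * eval p (Yv K s)) +
        U 0 1 * (eval p (Yv K i) - b * eval p (Yv K j)) = 0 := by
      intro p
      have h := hD p
      rw [D_phi, D_psi] at h
      have e1 := congrFun (congrFun h 0) 0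
      simpa [Matrix.mul_apply, Fin.sum_univ_two] using e1
    have h00 : U 0 0 = 0 := by
      rcases perm_cases i j s hperm hij with ⟨rfl, rfl, rfl⟩ | ⟨rfl, rfl, rfl⟩ | ⟨rfl, rfl, rfl⟩ <;>
      simpa [Yv] using h ![1, 0, 0, 0]
    have h01 : U 0 1 = 0 := by
      rcases perm_cases i j s hperm hij with ⟨rfl, rfl, rfl⟩ | ⟨rfl, rfl, rfl⟩ | ⟨rfl, rfl, rfl⟩
      · simpa [Yv] using h ![0, 1, 0, 0]
      · simpa [Yv] using h ![0, 1, 0, 0]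
      · simpa [Yv] using h ![0, 0, 1, 0]
    have hd := congrArg Matrix.det hU
    rw [Matrix.det_mul, Matrix.det_fin_two U, h00, h01] at hd
    simp at hd
end
end
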